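/- Jacobian of the congruence transformation on Hermitian matrices: for an invertible m × m complex matrix A, the real-linear map T ↦ A* T A on the real vector space of m × m Hermitian matrices has determinant equal to |det A|^{2m} (equivalently, det(A A*)^m), which is positive. -/

import Mathlib

open Matrix

/-- The complex-linear map `X ↦ Aᴴ X A`. -/
noncomputable def congrMap (m : ℕ) (A : Matrix (Fin m) (Fin m) ℂ) :
    Matrix (Fin m) (Fin m) ℂ →ₗ[ℂ] Matrix (Fin m) (Fin m) ℂ :=
  (LinearMap.mulRight ℂ A) ∘ₗ (LinearMap.mulLeft ℂ A.conjTranspose)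

lemma congrMap_apply (m : ℕ) (A X : Matrix (Fin m) (Fin m) ℂ) :
    congrMap m A X = A.conjTranspose * X * A := rfl

lemma congrMap_det (m : ℕ) (A : Matrix (Fin m) (Fin m) ℂ) :
    LinearMap.det (congrMap m A) = ((‖A.det‖ ^ (2 * m) : ℝ) : ℂ) := by
  have h : LinearMap.toMatrix (Matrix.stdBasis ℂ (Fin m) (Fin m))
      (Matrix.stdBasis ℂ (Fin m) (Fin m)) (congrMap m A)
      = Matrix.kroneckerMap (fun x y => x * y) A.conjTranspose A.transpose := by
    ext ⟨i, j⟩ ⟨k, l⟩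
    rw [LinearMap.toMatrix_apply, Matrix.stdBasis_eq_single, congrMap_apply]
    have : ∀ X : Matrix (Fin m) (Fin m) ℂ,
        (Matrix.stdBasis ℂ (Fin m) (Fin m)).repr X (i, j) = X i j := by
      intro X
      simp [Matrix.stdBasis]
    rw [this]
    simp [Matrix.mul_apply, Matrix.single_apply, Matrix.kronecker, ite_and, Finset.sum_ite_eq]
  rw [← LinearMap.det_toMatrix (Matrix.stdBasis ℂ (Fin m) (Fin m)), h, Matrix.det_kronecker,
    Matrix.det_conjTranspose, Matrix.det_transpose, ← mul_pow, Fintype.card_fin, pow_mul,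
    Complex.ofReal_pow, Complex.ofReal_pow, ← Complex.conj_mul']
  rfl

theorem det_congruence_hermitian (m : ℕ) (A : Matrix (Fin m) (Fin m) ℂ) (hA : A.det ≠ 0)
    (f : (selfAdjoint (Matrix (Fin m) (Fin m) ℂ)) →ₗ[ℝ]
         (selfAdjoint (Matrix (Fin m) (Fin m) ℂ)))
    (hf : ∀ T, (f T : Matrix (Fin m) (Fin m) ℂ)
        = A.conjTranspose * (T : Matrix (Fin m) (Fin m) ℂ) * A) :
    LinearMap.det f = ‖A.det‖ ^ (2 * m) := by
  classical
  have : Module.Finite ℝ (Matrix (Fin m) (Fin m) ℂ) := Module.Finite.trans ℂ _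
  have : Module.Finite ℝ (selfAdjoint (Matrix (Fin m) (Fin m) ℂ)) :=
    Module.Finite.of_injective (selfAdjoint.submodule ℝ (Matrix (Fin m) (Fin m) ℂ)).subtype
      Subtype.val_injective
  let b := Module.finBasis ℝ (selfAdjoint (Matrix (Fin m) (Fin m) ℂ))
  let v : _ → Matrix (Fin m) (Fin m) ℂ := fun i => (b i : Matrix (Fin m) (Fin m) ℂ)
  have hcoe : ∀ c : _ → ℝ, ((∑ i, c i • b i : selfAdjoint (Matrix (Fin m) (Fin m) ℂ)) :
      Matrix (Fin m) (Fin m) ℂ) = ∑ i, (c i : ℂ) • v i := by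
    intro c
    rw [AddSubgroup.val_finsetSum]
    rfl
  have hli : LinearIndependent ℂ v := by
    rw [Fintype.linearIndependent_iff]
    intro c hc i
    have hb := Fintype.linearIndependent_iff.1 b.linearIndependent
    have h1 := hb (fun i => (c i).re) (by
      have := congrArg realPart hc
      simpa [map_sum, realPart_smul, v, (b _).2.coe_realPart, (b _).2.imaginaryPart] using this)
    have h2 := hb (fun i => (c i).im) (by
      have := congrArg imaginaryPart hc
      simpa [map_sum, imaginaryPart_smul, v, (b _).2.coe_realPart, (b _).2.imaginaryPart] using this)
    exact Complex.ext (h1 i) (h2 i)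
  have hH : ∀ T : selfAdjoint (Matrix (Fin m) (Fin m) ℂ),
      (T : Matrix (Fin m) (Fin m) ℂ) ∈ Submodule.span ℂ (Set.range v) := by
    intro T
    rw [← b.sum_repr T, hcoe]
    exact Submodule.sum_mem _ fun i _ => Submodule.smul_mem _ _ (Submodule.subset_span ⟨i, rfl⟩)
  have hsp : ⊤ ≤ Submodule.span ℂ (Set.range v) := by
    intro X _
    rw [← realPart_add_I_smul_imaginaryPart X]
    exact Submodule.add_mem _ (hH _) (Submodule.smul_mem _ _ (hH _))
  let B := Module.Basis.mk hli hsp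
  have hB : ∀ i, B i = v i := fun i => by simp [B]
  have hM : LinearMap.toMatrix B B (congrMap m A) =
      (LinearMap.toMatrix b b f).map Complex.ofRealHom := by
    ext i j
    rw [LinearMap.toMatrix_apply, Matrix.map_apply, LinearMap.toMatrix_apply, hB, congrMap_apply]
    simp only [v]
    rw [← hf, ← b.sum_repr (f (b j)), hcoe]
    simp only [← hB, B.repr_sum_self, b.repr_sum_self]
    rfl
  have := congrMap_det m A
  rw [← LinearMap.det_toMatrix B, hM, ← RingHom.mapMatrix_apply, ← RingHom.map_det,
    LinearMap.det_toMatrix] at this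
  exact Complex.ofReal_injective this
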